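/- arXiv:2203.14322 — 7 statements merged into one kernel-verified Lean document; each statement's English description precedes it below -/
import Mathlib

section
/- Let M ≥ 1 be an integer, ω := exp(2πi/M), and let L be a finite subset of ZMod M. Fix a target label (k,κ) ∈ (ZMod M)², let d ≥ 1, let ι_A, ι_B be finite types, and let (E_{k',κ'})_{(k',κ')∈(ZMod M)²} be an orthonormal family in EuclideanSpace ℂ (ι_A × ι_B). Assume the target vector has the maximally entangled Schmidt form E_{k,κ}(i,j) = (1/√d)·∑_{s=0}^{d−1} a_s(i)·b_s(j) for some orthonormal family (a_s)_{s<d} in EuclideanSpace ℂ ι_A and orthonormal family (b_s)_{s<d} in EuclideanSpace ℂ ι_B. Define the weight w(k',κ') := (1 if κ' = κ else 0) + card{l ∈ L : k' + κ'·l = k + κ·l in ZMod M}, and assume the complementarity condition w(k',κ') ≤ 1 for every (k',κ') ≠ (k,κ). Then for all unit vectors u ∈ EuclideanSpace ℂ ι_A and v ∈ EuclideanSpace ℂ ι_B, setting ψ(i,j) := u(i)·v(j), one has (1/(1+|L|)) · ∑_{(k',κ')∈(ZMod M)²} w(k',κ') · |⟨E_{k',κ'}, ψ⟩|² ≤ (1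 + |L|/d)/(1 + |L|). -/
open scoped ComplexInnerProductSpace

section ProductVectors

variable {ιA ιB : Type*} [Fintype ιA] [Fintype ιB]

theorem norm_sq_of_apply_eq_mul (u : EuclideanSpace ℂ ιA) (v : EuclideanSpace ℂ ιB)
    (ψ : EuclideanSpace ℂ (ιA × ιB)) (hψ : ∀ i j, ψ (i, j) = u i * v j) :
    ‖ψ‖ ^ 2 = ‖u‖ ^ 2 * ‖v‖ ^ 2 := by
  simp only [EuclideanSpace.norm_sq_eq, Fintype.sum_prod_type, hψ, norm_mul, mul_pow,
    Finset.sum_mul_sum]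

theorem inner_schmidt_eq {σ : Type*} [Fintype σ] (c : ℂ) (a : σ → EuclideanSpace ℂ ιA)
    (b : σ → EuclideanSpace ℂ ιB) (φ ψ : EuclideanSpace ℂ (ιA × ιB))
    (hφ : ∀ i j, φ (i, j) = c * ∑ s, a s i * b s j)
    (u : EuclideanSpace ℂ ιA) (v : EuclideanSpace ℂ ιB) (hψ : ∀ i j, ψ (i, j) = u i * v j) :
    ⟪φ, ψ⟫ = starRingEnd ℂ c * ∑ s, ⟪a s, u⟫ * ⟪b s, v⟫ := by
  simp only [PiLp.inner_apply, RCLike.inner_apply, Fintype.sum_prod_type, hφ, hψ, map_mul,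
    map_sum, Finset.sum_mul_sum]
  simp only [Finset.mul_sum]
  rw [Finset.sum_comm_cycle]
  refine Finset.sum_congr rfl fun s _ => Finset.sum_congr rfl fun i _ =>
    Finset.sum_congr rfl fun j _ => ?_
  ring

/-- Cauchy–Schwarz and Bessel for the coefficients of two vectors in orthonormal families. -/
theorem norm_sum_inner_mul_inner_sq_le {σ E F : Type*} [Fintype σ]
    [NormedAddCommGroup E] [InnerProductSpace ℂ E] [NormedAddCommGroup F] [InnerProductSpace ℂ F]
    {a : σ → E} (ha : Orthonormal ℂ a) {b : σ → F} (hb : Orthonormal ℂ b) (u : E) (v : F) :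
    ‖∑ s, ⟪a s, u⟫ * ⟪b s, v⟫‖ ^ 2 ≤ ‖u‖ ^ 2 * ‖v‖ ^ 2 := by
  calc ‖∑ s, ⟪a s, u⟫ * ⟪b s, v⟫‖ ^ 2
      ≤ (∑ s, ‖⟪a s, u⟫‖ * ‖⟪b s, v⟫‖) ^ 2 := by
        gcongr
        exact (norm_sum_le _ _).trans_eq (by simp only [norm_mul])
    _ ≤ (∑ s, ‖⟪a s, u⟫‖ ^ 2) * ∑ s, ‖⟪b s, v⟫‖ ^ 2 := Finset.sum_mul_sq_le_sq_mul_sq _ _ _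
    _ ≤ ‖u‖ ^ 2 * ‖v‖ ^ 2 := by
        gcongr
        · exact ha.sum_inner_products_le u
        · exact hb.sum_inner_products_le v

end ProductVectors

theorem stmt0 (M : ℕ) (hM : 1 ≤ M) [NeZero M] (L : Finset (ZMod M)) (k κ : ZMod M)
    (d : ℕ) (hd : 1 ≤ d)
    (ιA ιB : Type) [Fintype ιA] [Fintype ιB]
    (E : ZMod M × ZMod M → EuclideanSpace ℂ (ιA × ιB))
    (hE : Orthonormal ℂ E)
    (a : Fin d → EuclideanSpace ℂ ιA) (ha : Orthonormal ℂ a)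
    (b : Fin d → EuclideanSpace ℂ ιB) (hb : Orthonormal ℂ b)
    (hSchmidt : ∀ (i : ιA) (j : ιB),
      E (k, κ) (i, j) = (1 / (Real.sqrt d : ℂ)) * ∑ s : Fin d, a s i * b s j)
    (w : ZMod M × ZMod M → ℕ)
    (hw : ∀ p : ZMod M × ZMod M,
      w p = (if p.2 = κ then 1 else 0) +
        (L.filter fun l => p.1 + p.2 * l = k + κ * l).card)
    (hcomp : ∀ p : ZMod M × ZMod M, p ≠ (k, κ) → w p ≤ 1)
    (u : EuclideanSpace ℂ ιA) (hu : ‖u‖ = 1)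
    (v : EuclideanSpace ℂ ιB) (hv : ‖v‖ = 1)
    (ψ : EuclideanSpace ℂ (ιA × ιB))
    (hψ : ∀ (i : ιA) (j : ιB), ψ (i, j) = u i * v j) :
    (1 / (1 + (L.card : ℝ))) * ∑ p : ZMod M × ZMod M, (w p : ℝ) * ‖⟪E p, ψ⟫‖ ^ 2
      ≤ (1 + (L.card : ℝ) / d) / (1 + (L.card : ℝ)) := by
  have hoverlap : ‖⟪E (k, κ), ψ⟫‖ ^ 2 ≤ 1 / d := by
    rw [inner_schmidt_eq _ a b _ ψ hSchmidt u v hψ, norm_mul, mul_pow]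
    have hc : ‖starRingEnd ℂ (1 / (Real.sqrt d : ℂ))‖ ^ 2 = 1 / d := by
      simp [abs_of_nonneg (Real.sqrt_nonneg _)]
    rw [hc]
    have h := norm_sum_inner_mul_inner_sq_le ha hb u v
    rw [hu, hv, one_pow, one_mul] at h
    exact mul_le_of_le_one_right (by positivity) h
  have hbessel : ∑ p, ‖⟪E p, ψ⟫‖ ^ 2 ≤ 1 := by
    have h := hE.sum_inner_products_le ψ (s := Finset.univ)
    rwa [norm_sq_of_apply_eq_mul u v ψ hψ, hu, hv, one_pow, one_mul] at h
  have hw₀ : w (k, κ) = 1 + L.card := by simp [hw]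
  have hsum : ∑ p, (w p : ℝ) * ‖⟪E p, ψ⟫‖ ^ 2 ≤
      ∑ p, (‖⟪E p, ψ⟫‖ ^ 2 + if p = (k, κ) then L.card * ‖⟪E p, ψ⟫‖ ^ 2 else 0) := by
    refine Finset.sum_le_sum fun p _ => ?_
    split_ifs with hp
    · rw [hp, hw₀]
      push_cast
      exact (by ring : _ = _).le
    · rw [add_zero]
      exact mul_le_of_le_one_left (by positivity) (by exact_mod_cast hcomp p hp)
  rw [Finset.sum_add_distrib, Finset.sum_ite_eq' Finset.univ (k, κ)] at hsum
  rw [one_div_mul_eq_div]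
  gcongr
  calc _ ≤ _ := hsum
    _ ≤ 1 + L.card * (1 / d : ℝ) := by
        rw [if_pos (Finset.mem_univ _)]
        gcongr
    _ = 1 + (L.card : ℝ) / d := by rw [mul_one_div]
end

section
/- Let M be a prime number, ω := exp(2πi/M), and let L be a finite subset of ZMod M. Fix (k,κ) ∈ (ZMod M)², let ι_A, ι_B be finite types, and let (E_{k',κ'})_{(k',κ')∈(ZMod M)²} be an orthonormal family in EuclideanSpace ℂ (ι_A × ι_B) such that the target vector has the Schmidt form E_{k,κ}(i,j) = (1/√M)·∑_{s=0}^{M−1} a_s(i)·b_s(j) for some orthonormal family (a_s)_{s<M} in EuclideanSpace ℂ ι_A and orthonormal family (b_s)_{s<M} in EuclideanSpace ℂ ι_B. Then for all unit vectors u ∈ EuclideanSpace ℂ ι_A and v ∈ EuclideanSpace ℂ ι_B, setting ψ(i,j) := u(i)·v(j), one has (1/(1+|L|)) · ∑_{(k',κ')∈(ZMod M)²} ((1 if κ' = κ else 0) + card{l ∈ L : k' + κ'·l = k + κ·l}) · |⟨E_{k',κ'}, ψ⟩|² ≤ (M + |L|)/(M·(|L| + 1)). -/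
open scoped ComplexInnerProductSpace

/-- The squared norm of a product vector is the product of the squared norms. -/
theorem norm_sq_product_vector {ιA ιB : Type*} [Fintype ιA] [Fintype ιB]
    (u : EuclideanSpace ℂ ιA) (v : EuclideanSpace ℂ ιB) (ψ : EuclideanSpace ℂ (ιA × ιB))
    (hψ : ∀ i j, ψ (i, j) = u i * v j) : ‖ψ‖ ^ 2 = ‖u‖ ^ 2 * ‖v‖ ^ 2 := by
  simp only [EuclideanSpace.norm_sq_eq, Fintype.sum_prod_type, hψ, norm_mul, mul_pow,
    Finset.sum_mul_sum]

/-- The overlap of a vector in Schmidt form with equal coefficients `c` and a product vector. -/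
theorem inner_schmidt_product_vector {σ ιA ιB : Type*} [Fintype σ] [Fintype ιA] [Fintype ιB]
    (c : ℂ) (a : σ → EuclideanSpace ℂ ιA) (b : σ → EuclideanSpace ℂ ιB)
    (φ ψ : EuclideanSpace ℂ (ιA × ιB)) (hφ : ∀ i j, φ (i, j) = c * ∑ s, a s i * b s j)
    (u : EuclideanSpace ℂ ιA) (v : EuclideanSpace ℂ ιB)
    (hψ : ∀ i j, ψ (i, j) = u i * v j) :
    ⟪φ, ψ⟫ = starRingEnd ℂ c * ∑ s, ⟪a s, u⟫ * ⟪b s, v⟫ := by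
  simp_rw [PiLp.inner_apply, RCLike.inner_apply, Fintype.sum_prod_type, hφ, hψ, map_mul, map_sum,
    Finset.sum_mul_sum, Finset.mul_sum]
  rw [Finset.sum_comm (s := (Finset.univ : Finset σ))]
  refine Finset.sum_congr rfl fun i _ => ?_
  rw [Finset.sum_comm (s := (Finset.univ : Finset σ))]
  refine Finset.sum_congr rfl fun j _ => Finset.sum_congr rfl fun s _ => ?_
  rw [map_mul]
  ring

/-- Pairing the coefficients of two unit vectors along orthonormal families gives a number of
modulus at most one. -/
theorem norm_sum_inner_mul_inner_le_one {σ F G : Type*} [Fintype σ]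
    [NormedAddCommGroup F] [InnerProductSpace ℂ F] [NormedAddCommGroup G] [InnerProductSpace ℂ G]
    {a : σ → F} (ha : Orthonormal ℂ a) {b : σ → G} (hb : Orthonormal ℂ b)
    {u : F} (hu : ‖u‖ = 1) {v : G} (hv : ‖v‖ = 1) :
    ‖∑ s, ⟪a s, u⟫ * ⟪b s, v⟫‖ ≤ 1 := by
  have hA := ha.sum_inner_products_le u (s := Finset.univ)
  have hB := hb.sum_inner_products_le v (s := Finset.univ)
  rw [hu] at hA
  rw [hv] at hB
  calc ‖∑ s, ⟪a s, u⟫ * ⟪b s, v⟫‖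
      ≤ ∑ s, (‖⟪a s, u⟫‖ ^ 2 + ‖⟪b s, v⟫‖ ^ 2) / 2 := by
        refine norm_sum_le_of_le _ fun s _ => ?_
        rw [norm_mul]
        linarith [two_mul_le_add_sq ‖⟪a s, u⟫‖ ‖⟪b s, v⟫‖]
    _ ≤ 1 := by
        rw [← Finset.sum_div, Finset.sum_add_distrib]
        linarith

/-- Away from the point `(k, κ)`, at most one of the lines through it, with slopes in `L` or
vertical, contains a given point. -/
theorem weight_le_one_of_ne {K : Type*} [Field K] [DecidableEq K] (L : Finset K) (k κ : K)
    (p : K × K) (hp : p ≠ (k, κ)) :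
    (if p.2 = κ then 1 else 0) + (L.filter fun l => p.1 + p.2 * l = k + κ * l).card ≤ 1 := by
  obtain ⟨k', κ'⟩ := p
  by_cases h : κ' = κ
  · subst h
    have hk : k' ≠ k := fun hk => hp (by rw [hk])
    simp [hk]
  · simp only [h, if_false, zero_add]
    refine Finset.card_le_one.2 fun x hx y hy => ?_
    have hx' := (Finset.mem_filter.1 hx).2
    have hy' := (Finset.mem_filter.1 hy).2
    refine mul_left_cancel₀ (sub_ne_zero.2 h) ?_
    linear_combination hx' - hy'

theorem stmt1 (M : ℕ) (hM : M.Prime) [NeZero M] (L : Finset (ZMod M)) (k κ : ZMod M)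
    (ιA ιB : Type) [Fintype ιA] [Fintype ιB]
    (E : ZMod M × ZMod M → EuclideanSpace ℂ (ιA × ιB))
    (hE : Orthonormal ℂ E)
    (a : Fin M → EuclideanSpace ℂ ιA) (ha : Orthonormal ℂ a)
    (b : Fin M → EuclideanSpace ℂ ιB) (hb : Orthonormal ℂ b)
    (hSchmidt : ∀ (i : ιA) (j : ιB),
      E (k, κ) (i, j) = (1 / (Real.sqrt M : ℂ)) * ∑ s : Fin M, a s i * b s j)
    (u : EuclideanSpace ℂ ιA) (hu : ‖u‖ = 1)
    (v : EuclideanSpace ℂ ιB) (hv : ‖v‖ = 1)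
    (ψ : EuclideanSpace ℂ (ιA × ιB))
    (hψ : ∀ (i : ιA) (j : ιB), ψ (i, j) = u i * v j) :
    (1 / (1 + (L.card : ℝ))) * ∑ p : ZMod M × ZMod M,
        ((((if p.2 = κ then 1 else 0) +
          (L.filter fun l => p.1 + p.2 * l = k + κ * l).card : ℕ)) : ℝ) * ‖⟪E p, ψ⟫‖ ^ 2
      ≤ ((M : ℝ) + L.card) / (M * (L.card + 1)) := by
  have : Fact M.Prime := ⟨hM⟩
  have hM0 : (0 : ℝ) < M := by exact_mod_cast hM.pos
  have hψ1 : ‖ψ‖ ^ 2 = 1 := by rw [norm_sq_product_vector u v ψ hψ, hu, hv]; norm_num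
  have hBessel : ∑ p, ‖⟪E p, ψ⟫‖ ^ 2 ≤ 1 :=
    hψ1 ▸ hE.sum_inner_products_le ψ (s := Finset.univ)
  have hTarget : ‖⟪E (k, κ), ψ⟫‖ ^ 2 ≤ 1 / M := by
    rw [inner_schmidt_product_vector _ a b _ ψ hSchmidt u v hψ, norm_mul, mul_pow, RCLike.norm_conj,
      norm_div, norm_one, Complex.norm_real, Real.norm_of_nonneg (Real.sqrt_nonneg _), div_pow,
      Real.sq_sqrt hM0.le, one_pow]
    exact mul_le_of_le_one_right (by positivity)
      (pow_le_one₀ (norm_nonneg _) (norm_sum_inner_mul_inner_le_one ha hb hu hv))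
  have hSum : ∑ p : ZMod M × ZMod M,
      ((((if p.2 = κ then 1 else 0) +
        (L.filter fun l => p.1 + p.2 * l = k + κ * l).card : ℕ)) : ℝ) * ‖⟪E p, ψ⟫‖ ^ 2
      ≤ ∑ p, (‖⟪E p, ψ⟫‖ ^ 2 + if p = (k, κ) then L.card * ‖⟪E p, ψ⟫‖ ^ 2 else 0) := by
    refine Finset.sum_le_sum fun p _ => ?_
    by_cases hp : p = (k, κ)
    · subst hp
      simp [add_mul]
    · rw [if_neg hp, add_zero]
      exact mul_le_of_le_one_left (by positivity)
        (by exact_mod_cast weight_le_one_of_ne L k κ p hp)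
  rw [Finset.sum_add_distrib, Finset.sum_ite_eq' Finset.univ (k, κ), if_pos (Finset.mem_univ _)]
    at hSum
  have hL := mul_le_mul_of_nonneg_left hTarget (Nat.cast_nonneg (α := ℝ) L.card)
  calc _ ≤ 1 / (1 + (L.card : ℝ)) * (1 + L.card * (1 / M)) :=
        mul_le_mul_of_nonneg_left (by linarith) (by positivity)
    _ = _ := by field_simp; ring
end

section
/- Let ι_A and ι_B be finite types, let d ≥ 1, let (a_s)_{s<d} be an orthonormal family in EuclideanSpace ℂ ι_A and (b_s)_{s<d} an orthonormal family in EuclideanSpace ℂ ι_B. Define E ∈ EuclideanSpace ℂ (ι_A × ι_B) by E(i,j) := (1/√d)·∑_{s=0}^{d−1} a_s(i)·b_s(j). Then E is a unit vector, and for all unit vectors u ∈ EuclideanSpace ℂ ι_A and v ∈ EuclideanSpace ℂ ι_B, setting ψ(i,j) := u(i)·v(j), one has |⟨E, ψ⟩|² ≤ 1/d. -/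
open scoped ComplexInnerProductSpace

/-- The product vector `u ⊗ v`, with coordinates `u i * v j`. -/
noncomputable def productVector {ι κ : Type*} (u : EuclideanSpace ℂ ι) (v : EuclideanSpace ℂ κ) :
    EuclideanSpace ℂ (ι × κ) :=
  WithLp.toLp 2 fun p => u p.1 * v p.2

theorem inner_productVector {ι κ : Type*} [Fintype ι] [Fintype κ]
    (u u' : EuclideanSpace ℂ ι) (v v' : EuclideanSpace ℂ κ) :
    ⟪productVector u v, productVector u' v'⟫ = ⟪u, u'⟫ * ⟪v, v'⟫ := by
  simp only [PiLp.inner_apply, productVector, RCLike.inner_apply, map_mul,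
    Fintype.sum_prod_type, Finset.sum_mul_sum]
  exact Finset.sum_congr rfl fun i _ => Finset.sum_congr rfl fun j _ => by ring

theorem Orthonormal.productVector {ι κ σ : Type*} [Fintype ι] [Fintype κ]
    {a : σ → EuclideanSpace ℂ ι} {b : σ → EuclideanSpace ℂ κ}
    (ha : Orthonormal ℂ a) (hb : Orthonormal ℂ b) :
    Orthonormal ℂ fun s => productVector (a s) (b s) := by
  classical
  rw [orthonormal_iff_ite] at ha hb ⊢
  intro s t
  rw [inner_productVector, ha, hb]
  split_ifs <;> simp

theorem Orthonormal.norm_sum_sq {𝕜 F σ : Type*} [RCLike 𝕜] [NormedAddCommGroup F]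
    [InnerProductSpace 𝕜 F] [Fintype σ] {e : σ → F} (he : Orthonormal 𝕜 e) :
    ‖∑ s, e s‖ ^ 2 = Fintype.card σ := by
  classical
  rw [← RCLike.ofReal_inj (K := 𝕜), RCLike.ofReal_pow, ← inner_self_eq_norm_sq_to_K (𝕜 := 𝕜),
    sum_inner]
  simp [inner_sum, orthonormal_iff_ite.mp he]

/-- Cauchy–Schwarz and Bessel applied to the Schmidt coefficients of a product vector. -/
theorem Orthonormal.norm_sum_inner_mul_inner_le {𝕜 F G σ : Type*} [RCLike 𝕜]
    [NormedAddCommGroup F] [InnerProductSpace 𝕜 F]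
    [NormedAddCommGroup G] [InnerProductSpace 𝕜 G] [Fintype σ]
    {a : σ → F} {b : σ → G} (ha : Orthonormal 𝕜 a) (hb : Orthonormal 𝕜 b) (u : F) (v : G) :
    ‖∑ s, inner 𝕜 (a s) u * inner 𝕜 (b s) v‖ ^ 2 ≤ ‖u‖ ^ 2 * ‖v‖ ^ 2 := by
  calc ‖∑ s, inner 𝕜 (a s) u * inner 𝕜 (b s) v‖ ^ 2
      ≤ (∑ s, ‖inner 𝕜 (a s) u‖ * ‖inner 𝕜 (b s) v‖) ^ 2 := by
        gcongr
        exact (norm_sum_le _ _).trans_eq (by simp only [norm_mul])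
    _ ≤ (∑ s, ‖inner 𝕜 (a s) u‖ ^ 2) * ∑ s, ‖inner 𝕜 (b s) v‖ ^ 2 :=
        Finset.sum_mul_sq_le_sq_mul_sq _ _ _
    _ ≤ ‖u‖ ^ 2 * ‖v‖ ^ 2 := by
        gcongr
        · exact ha.sum_inner_products_le u
        · exact hb.sum_inner_products_le v

theorem stmt3 (ιA ιB : Type) [Fintype ιA] [Fintype ιB]
    (d : ℕ) (hd : 1 ≤ d)
    (a : Fin d → EuclideanSpace ℂ ιA) (ha : Orthonormal ℂ a)
    (b : Fin d → EuclideanSpace ℂ ιB) (hb : Orthonormal ℂ b)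
    (E : EuclideanSpace ℂ (ιA × ιB))
    (hEdef : ∀ (i : ιA) (j : ιB),
      E (i, j) = (1 / (Real.sqrt d : ℂ)) * ∑ s : Fin d, a s i * b s j) :
    ‖E‖ = 1 ∧
      ∀ (u : EuclideanSpace ℂ ιA) (v : EuclideanSpace ℂ ιB), ‖u‖ = 1 → ‖v‖ = 1 →
        ∀ ψ : EuclideanSpace ℂ (ιA × ιB), (∀ (i : ιA) (j : ιB), ψ (i, j) = u i * v j) →
          ‖⟪E, ψ⟫‖ ^ 2 ≤ 1 / (d : ℝ) := by
  have hE : E = (1 / (Real.sqrt d : ℂ)) • ∑ s, productVector (a s) (b s) := by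
    ext ⟨i, j⟩
    simp [hEdef, productVector]
  have hc : ‖(1 / (Real.sqrt d : ℂ))‖ ^ 2 = 1 / (d : ℝ) := by
    simp [Real.sq_sqrt]
  constructor
  · have hd' : (d : ℝ) ≠ 0 := by positivity
    have hsq : ‖E‖ ^ 2 = 1 := by
      rw [hE, norm_smul, mul_pow, hc, (ha.productVector hb).norm_sum_sq, Fintype.card_fin,
        one_div_mul_cancel hd']
    exact (pow_eq_one_iff_of_nonneg (norm_nonneg _) two_ne_zero).mp hsq
  · intro u v hu hv ψ hψ
    obtain rfl : ψ = productVector u v := by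
      ext ⟨i, j⟩
      exact hψ i j
    have hle := ha.norm_sum_inner_mul_inner_le hb u v
    rw [hu, hv, one_pow, one_mul] at hle
    rw [hE, inner_smul_left, norm_mul, RCLike.norm_conj, mul_pow, hc, sum_inner]
    simp only [inner_productVector]
    exact mul_le_of_le_one_right (by positivity) hle
end

section
/- Let V be a complex inner product space, U : V → V a linear isometry, M ≥ 1, d a positive divisor of M, ω := exp(2πi/M), and ψ ∈ V a vector such that U^d ψ = ψ and the family (U^m ψ)_{0 ≤ m < d} is orthonormal. Then for every integer k, the vector v := ∑_{m=0}^{M−1} ω^{−k·m}·U^m ψ satisfies: if M divides k·d then ‖v‖ = M/√d, so that (√d/M)·v is a unit vector; and if M does not divide k·d then v = 0. -/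
/-- If `U ^ d` fixes `ψ`, a twisted orbit sum of length `d * e` is a geometric sum in `ζ ^ d` times
the twisted sum over one period. -/
theorem sum_range_mul_pow_smul_of_pow_apply_eq {R E : Type*} [CommRing R] [AddCommGroup E]
    [Module R E] (U : Module.End R E) {d : ℕ} {ψ : E} (hψ : (U ^ d) ψ = ψ) (ζ : R) (e : ℕ) :
    ∑ m ∈ Finset.range (d * e), ζ ^ m • (U ^ m) ψ =
      (∑ i ∈ Finset.range e, (ζ ^ d) ^ i) • ∑ j ∈ Finset.range d, ζ ^ j • (U ^ j) ψ := by
  have hψe (n : ℕ) : (U ^ (d * n)) ψ = ψ := by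
    induction n with
    | zero => simp
    | succ n ih => rw [Nat.mul_succ, pow_add, Module.End.mul_apply, hψ, ih]
  induction e with
  | zero => simp
  | succ e ih =>
    rw [Nat.mul_succ, Finset.sum_range_add, ih, Finset.sum_range_succ, add_smul]
    congr 1
    rw [Finset.smul_sum]
    refine Finset.sum_congr rfl fun j _ => ?_
    rw [smul_smul, pow_add, pow_mul, add_comm, pow_add U, Module.End.mul_apply, hψe]

/-- A combination of `d` orthonormal vectors with unimodular coefficients has norm `√d`. -/
theorem Orthonormal.norm_sum_smul_of_norm_eq_one {𝕜 E ι : Type*} [RCLike 𝕜]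
    [NormedAddCommGroup E] [InnerProductSpace 𝕜 E] [Fintype ι] {b : ι → E}
    (hb : Orthonormal 𝕜 b) {c : ι → 𝕜} (hc : ∀ i, ‖c i‖ = 1) :
    ‖∑ i, c i • b i‖ = √(Fintype.card ι) := by
  rw [@norm_eq_sqrt_re_inner 𝕜, hb.inner_sum]
  simp [RCLike.conj_mul, hc]


theorem stmt8 (V : Type) [NormedAddCommGroup V] [InnerProductSpace ℂ V]
    (U : Module.End ℂ V) (hU : ∀ x : V, ‖U x‖ = ‖x‖)
    (M d : ℕ) (hM : 1 ≤ M) (hd : 0 < d) (hdM : d ∣ M)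
    (ω : ℂ) (hω : ω = Complex.exp (2 * Real.pi * Complex.I / M))
    (ψ : V) (hψd : (U ^ d) ψ = ψ)
    (horth : Orthonormal ℂ (fun m : Fin d => (U ^ (m : ℕ)) ψ))
    (k : ℤ)
    (v : V) (hv : v = ∑ m ∈ Finset.range M, ω ^ (-(k * (m : ℤ))) • (U ^ m) ψ) :
    ((M : ℤ) ∣ k * d →
      ‖v‖ = M / Real.sqrt d ∧ ‖((Real.sqrt d / M : ℝ) : ℂ) • v‖ = 1) ∧
    (¬ (M : ℤ) ∣ k * d → v = 0) := by
  have hω_prim : IsPrimitiveRoot ω M := hω ▸ Complex.isPrimitiveRoot_exp M (by omega)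
  have hω_norm : ‖ω‖ = 1 := hω_prim.norm'_eq_one (by omega)
  obtain ⟨e, rfl⟩ := hdM
  have he : (e : ℝ) ≠ 0 := by
    rintro h
    simp_all
  have hsqrt : 0 < √(d : ℝ) := by positivity
  have hdd : √(d : ℝ) * √d = d := Real.mul_self_sqrt d.cast_nonneg
  set ζ : ℂ := ω ^ (-k) with hζ
  have hζ_norm : ‖ζ‖ = 1 := by simp [hζ, hω_norm]
  have hζd : ζ ^ d = 1 ↔ ((d * e : ℕ) : ℤ) ∣ k * d := by
    rw [hζ, ← zpow_natCast, ← zpow_mul, hω_prim.zpow_eq_one_iff_dvd, neg_mul, dvd_neg]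
  have hζde : (ζ ^ d) ^ e = 1 := by
    rw [← pow_mul, hζ, ← zpow_natCast, ← zpow_mul, hω_prim.zpow_eq_one_iff_dvd]
    exact dvd_mul_left _ _
  have hv' : v = (∑ i ∈ Finset.range e, (ζ ^ d) ^ i) •
      ∑ j ∈ Finset.range d, ζ ^ j • (U ^ j) ψ := by
    rw [← sum_range_mul_pow_smul_of_pow_apply_eq U hψd, hv]
    refine Finset.sum_congr rfl fun m _ => ?_
    rw [hζ, ← zpow_natCast, ← zpow_mul, neg_mul]
  refine ⟨fun h => ?_, fun h => ?_⟩
  · have hperiod : ‖∑ j ∈ Finset.range d, ζ ^ j • (U ^ j) ψ‖ = √d := by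
      rw [Finset.sum_range]
      simpa using horth.norm_sum_smul_of_norm_eq_one (c := fun j : Fin d => ζ ^ (j : ℕ))
        fun j => by simp [hζ_norm]
    have hnorm : ‖v‖ = (d * e : ℕ) / √d := by
      rw [hv', norm_smul, hperiod, hζd.mpr h, eq_div_iff hsqrt.ne', mul_assoc, hdd]
      simp [mul_comm]
    refine ⟨hnorm, ?_⟩
    rw [norm_smul, hnorm, Complex.norm_real, Real.norm_of_nonneg (by positivity)]
    have hdR : (d : ℝ) ≠ 0 := by positivity
    push_cast
    field_simp
  · rw [hv', geom_sum_eq (mt hζd.mp h), hζde, sub_self, zero_div, zero_smul]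
end

section
/- Fix integers M ≥ 1 and N ≥ 0 and let ω := exp(2πi/M). On the N-photon sector H_{M,N} := EuclideanSpace ℂ over the finite type {n : ZMod M → ℕ // ∑_m n(m) = N}, define the mode-shift unitary X̂ by X̂ e_n = e_{X·n} where (X·n)(m) := n(m−1), and the phase-shift unitary Ẑ by Ẑ e_n = ω^{μ(n)} e_n where μ(n) := ∑_{m∈ZMod M} n(m)·m ∈ ZMod M. Then Ẑ ∘ X̂ = ω^N · (X̂ ∘ Ẑ). -/
noncomputable section

/-- The `N`-photon sector of an `M`-mode multi-rail system:
Fock vectors `n : ZMod M → ℕ` with total photon number `N`. -/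
def Fock (M N : ℕ) [NeZero M] : Type :=
  {n : ZMod M → ℕ // ∑ m : ZMod M, n m = N}

/-- The cyclic mode shift on Fock vectors, `(X·n)(m) = n(m-1)`. -/
def Fock.shift {M N : ℕ} [NeZero M] (n : Fock M N) : Fock M N :=
  ⟨fun m => n.1 (m - 1),
    (Fintype.sum_equiv (Equiv.subRight (1 : ZMod M))
      (fun m => n.1 (m - 1)) n.1 (fun _ => rfl)).trans n.2⟩

/-- The Z-clock label `μ(n) = ∑ m, n(m)·m ∈ ZMod M` of a Fock vector. -/
def Fock.mu {M N : ℕ} [NeZero M] (n : Fock M N) : ZMod M :=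
  ∑ m : ZMod M, (n.1 m : ZMod M) * m

/-- The mode shift raises the Z-clock label by the photon number. -/
theorem Fock.mu_shift {M N : ℕ} [NeZero M] (n : Fock M N) :
    n.shift.mu = n.mu + (N : ZMod M) := by
  have hsum : n.shift.mu = ∑ m : ZMod M, (n.1 m : ZMod M) * (m + 1) :=
    Fintype.sum_equiv (Equiv.subRight (1 : ZMod M)) _ _ fun m => by
      simp [Fock.shift]
  have hN : (N : ZMod M) = ∑ m : ZMod M, (n.1 m : ZMod M) := by
    rw [← Nat.cast_sum, n.2]
  rw [hsum, hN, Fock.mu, ← Finset.sum_add_distrib]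
  simp only [mul_add, mul_one]

/-- Powers of an `M`-th root of unity depend only on the exponent modulo `M`. -/
theorem pow_val_add_natCast {R : Type*} [Monoid R] {M : ℕ} [NeZero M] {ω : R}
    (hω : ω ^ M = 1) (a : ZMod M) (k : ℕ) :
    ω ^ (a + (k : ZMod M)).val = ω ^ k * ω ^ a.val := by
  rw [← pow_add, ← ZMod.natCast_zmod_val a, ← Nat.cast_add, ZMod.val_natCast,
    ZMod.natCast_zmod_val, ← pow_eq_pow_mod _ hω, add_comm]

theorem stmt11 (M N : ℕ) (hM : 1 ≤ M) [NeZero M]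
    [Fintype (Fock M N)] [DecidableEq (Fock M N)]
    (ω : ℂ) (hω : ω = Complex.exp (2 * Real.pi * Complex.I / M))
    (X Z : Module.End ℂ (EuclideanSpace ℂ (Fock M N)))
    (hX : ∀ n : Fock M N,
      X (EuclideanSpace.single n 1) = EuclideanSpace.single n.shift 1)
    (hZ : ∀ n : Fock M N,
      Z (EuclideanSpace.single n 1) = ω ^ (Fock.mu n).val • EuclideanSpace.single n 1) :
    Z ∘ₗ X = ω ^ N • (X ∘ₗ Z) := by
  have hωM : ω ^ M = 1 := by
    rw [hω]
    exact (Complex.isPrimitiveRoot_exp M (NeZero.ne M)).pow_eq_one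
  refine (EuclideanSpace.basisFun (Fock M N) ℂ).toBasis.ext fun n => ?_
  simp only [OrthonormalBasis.coe_toBasis, EuclideanSpace.basisFun_apply,
    LinearMap.comp_apply, LinearMap.smul_apply]
  rw [hX, hZ, hZ, map_smul, hX, smul_smul, Fock.mu_shift, pow_val_add_natCast hωM]
end
end

section
/- Let M be a prime number, fix (k,κ) ∈ (ZMod M)², and let c : (ZMod M)² → ℂ satisfy ∑_{(k',κ')} |c(k',κ')|² = 1. Then (1/(M+1)) · ∑_{(k',κ')∈(ZMod M)²} |c(k',κ')|² · ((1 if κ' = κ else 0) + card{l ∈ ZMod M : k' + κ'·l = k + κ·l}) = (1 + M·|c(k,κ)|²)/(M + 1). -/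
/-- In the affine plane over a finite field, the points on the graph of `l ↦ k + κ * l` shared with
the graph of `l ↦ a + b * l`, together with their common point at infinity if the lines are
parallel, number one for distinct lines. -/
theorem ite_add_card_filter_affine_eq {F : Type*} [Field F] [Fintype F] [DecidableEq F]
    (k κ : F) (p : F × F) :
    (if p.2 = κ then 1 else 0) +
        (Finset.univ.filter fun l : F => p.1 + p.2 * l = k + κ * l).card =
      1 + if p = (k, κ) then Fintype.card F else 0 := by
  obtain ⟨a, b⟩ := p
  by_cases hb : b = κ
  · subst hb
    by_cases ha : a = k <;> simp [ha]
  · have hsub : b - κ ≠ 0 := sub_ne_zero.mpr hb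
    have hfilter : (Finset.univ.filter fun l : F => a + b * l = k + κ * l) =
        {(k - a) / (b - κ)} := by
      ext l
      simp only [Finset.mem_filter, Finset.mem_univ, true_and, Finset.mem_singleton,
        eq_div_iff hsub]
      constructor <;> intro h <;> linear_combination h
    simp [hb, hfilter]

theorem stmt14 (M : ℕ) (hM : M.Prime) [NeZero M] (k κ : ZMod M)
    (c : ZMod M × ZMod M → ℂ)
    (hc : ∑ p : ZMod M × ZMod M, ‖c p‖ ^ 2 = 1) :
    (1 / ((M : ℝ) + 1)) * ∑ p : ZMod M × ZMod M, ‖c p‖ ^ 2 *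
        ((((if p.2 = κ then 1 else 0) +
          (Finset.univ.filter fun l : ZMod M => p.1 + p.2 * l = k + κ * l).card : ℕ)) : ℝ)
      = (1 + (M : ℝ) * ‖c (k, κ)‖ ^ 2) / ((M : ℝ) + 1) := by
  have : Fact M.Prime := ⟨hM⟩
  simp_rw [ite_add_card_filter_affine_eq k κ, ZMod.card, Nat.cast_add, Nat.cast_ite, mul_add,
    Finset.sum_add_distrib]
  simp only [Nat.cast_one, mul_one, hc, Nat.cast_zero, mul_ite, mul_zero, Finset.sum_ite_eq',
    Finset.mem_univ, if_true]
  ring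
end

section
/- Fix integers M ≥ 1, P ≥ 1 and N₁, …, N_P ≥ 0 with ∑_i N_i = M, and let ω := exp(2πi/M). Let S be the finite set of P-tuples (n₁,…,n_P) of Fock vectors n_i : ZMod M → ℕ such that ∑_m n_i(m) = N_i for each i and ∑_{i=1}^P n_i(m) = 1 for every mode m ∈ ZMod M. On H := EuclideanSpace ℂ S, define the simultaneous mode-shift unitary X̂_P by X̂_P e_{(n₁,…,n_P)} = e_{(X·n₁,…,X·n_P)} where (X·n)(m) := n(m−1) (this is well defined since the simultaneous shift maps S bijectively onto itself), and the simultaneous phase-shift unitary Ẑ_P by Ẑ_P e_{(n₁,…,n_P)} = ω^{∑_i μ(n_i)} e_{(n₁,…,n_P)} where μ(n) := ∑_{m∈ZMod M} n(m)·m. Then the uniform superposition Φ := (1/√(card S))·∑_{s∈S} e_s satisfies X̂_P Φ = Φ and Ẑ_P Φ = ω^{M(M−1)/2} Φ. -/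
noncomputable section

/-- `P`-tuples of Fock vectors on `M` modes with local photon numbers `N i`
and exactly one photon in each mode in total. -/
def FockTuples (M P : ℕ) [NeZero M] (N : Fin P → ℕ) : Type :=
  {n : Fin P → ZMod M → ℕ //
    (∀ i : Fin P, ∑ m : ZMod M, n i m = N i) ∧ ∀ m : ZMod M, ∑ i : Fin P, n i m = 1}

/-- The simultaneous cyclic mode shift on tuples of Fock vectors. -/
def FockTuples.shift {M P : ℕ} [NeZero M] {N : Fin P → ℕ}
    (n : FockTuples M P N) : FockTuples M P N :=
  ⟨fun i m => n.1 i (m - 1),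
    ⟨fun i => (Fintype.sum_equiv (Equiv.subRight (1 : ZMod M))
        (fun m => n.1 i (m - 1)) (n.1 i) (fun _ => rfl)).trans (n.2.1 i),
      fun m => n.2.2 (m - 1)⟩⟩

/-- The simultaneous mode shift is injective. -/
theorem FockTuples.shift_injective {M P : ℕ} [NeZero M] {N : Fin P → ℕ} :
    Function.Injective (FockTuples.shift : FockTuples M P N → FockTuples M P N) := by
  intro a b h
  refine Subtype.ext (funext fun i => funext fun m => ?_)
  have := congrFun (congrFun (congrArg Subtype.val h) i) (m + 1)
  simpa [FockTuples.shift] using this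

/-- The residues modulo `M` sum to `M (M - 1) / 2`. -/
theorem ZMod.sum_univ_eq (M : ℕ) [NeZero M] :
    ∑ m : ZMod M, m = ((M * (M - 1) / 2 : ℕ) : ZMod M) := by
  rw [← Finset.sum_range_id, Nat.cast_sum]
  refine Finset.sum_bij' (fun m _ => m.val) (fun i _ => (i : ZMod M)) ?_ ?_ ?_ ?_ ?_
  · exact fun m _ => Finset.mem_range.2 m.val_lt
  · exact fun _ _ => Finset.mem_univ _
  · exact fun m _ => ZMod.natCast_zmod_val m
  · exact fun i hi => ZMod.val_cast_of_lt (Finset.mem_range.1 hi)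
  · exact fun m _ => (ZMod.natCast_zmod_val m).symm

/-- All tuples with one photon per mode have the same total phase charge. -/
theorem FockTuples.sum_charge {M P : ℕ} [NeZero M] {N : Fin P → ℕ} (n : FockTuples M P N) :
    ∑ i : Fin P, ∑ m : ZMod M, (n.1 i m : ZMod M) * m =
      ((M * (M - 1) / 2 : ℕ) : ZMod M) := by
  rw [Finset.sum_comm, ← ZMod.sum_univ_eq]
  refine Finset.sum_congr rfl fun m _ => ?_
  rw [← Finset.sum_mul, ← Nat.cast_sum, n.2.2 m, Nat.cast_one, one_mul]

theorem stmt15 (M P : ℕ) (hM : 1 ≤ M) [NeZero M] (hP : 1 ≤ P)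
    (N : Fin P → ℕ) (hN : ∑ i : Fin P, N i = M)
    [Fintype (FockTuples M P N)] [DecidableEq (FockTuples M P N)]
    (ω : ℂ) (hω : ω = Complex.exp (2 * Real.pi * Complex.I / M))
    (XP ZP : Module.End ℂ (EuclideanSpace ℂ (FockTuples M P N)))
    (hX : ∀ n : FockTuples M P N,
      XP (EuclideanSpace.single n 1) = EuclideanSpace.single n.shift 1)
    (hZ : ∀ n : FockTuples M P N,
      ZP (EuclideanSpace.single n 1) =
        ω ^ (∑ i : Fin P, ∑ m : ZMod M, (n.1 i m : ZMod M) * m).val •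
          EuclideanSpace.single n 1)
    (Φ : EuclideanSpace ℂ (FockTuples M P N))
    (hΦ : Φ = ((1 / Real.sqrt (Fintype.card (FockTuples M P N)) : ℝ) : ℂ) •
      ∑ n : FockTuples M P N, EuclideanSpace.single n 1) :
    XP Φ = Φ ∧ ZP Φ = ω ^ (M * (M - 1) / 2) • Φ := by
  have hωM : ω ^ M = 1 := by
    rw [hω]
    exact (Complex.isPrimitiveRoot_exp M (NeZero.ne M)).pow_eq_one
  subst hΦ
  constructor
  · rw [map_smul, map_sum]
    simp only [hX]
    congr 1
    exact Function.Bijective.sum_comp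
      (Finite.injective_iff_bijective.1 FockTuples.shift_injective)
      (fun n : FockTuples M P N =>
        (EuclideanSpace.single n 1 : EuclideanSpace ℂ (FockTuples M P N)))
  · rw [map_smul, map_sum, smul_comm (ω ^ (M * (M - 1) / 2))]
    congr 1
    rw [Finset.smul_sum]
    refine Finset.sum_congr rfl fun n _ => ?_
    rw [hZ, n.sum_charge, ZMod.val_natCast, ← pow_eq_pow_mod _ hωM]
end
end
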